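/- Let f ∈ Q̄[X,Y] be an irreducible polynomial defining the curve C = {(x,y) ∈ (Q̄^×)² : f(x,y)=0}, and assume C is not a translate of a subtorus. Then for every pair of integers (p,q) ≠ (0,0), the set of points P = (x,y) ∈ (Q̄^×)² with f(x,y) = 0, ((∂f/∂X)(P), (∂f/∂Y)(P)) ≠ (0,0), and q·x·(∂f/∂X)(P) = p·y·(∂f/∂Y)(P) has cardinality at most (deg f)². (This set is the fiber σ_C^{-1}(p:q) of the tangent map σ_C over the rational point (p:q) ∈ P¹.) -/

import Mathlib

open NumberField IsDedekindDomain MvPolynomial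
open scoped Classical

/-- `Qbar` is the field of algebraic numbers, the algebraic closure of `ℚ`. -/
noncomputable abbrev Qbar : Type := AlgebraicClosure ℚ

/-- The curve in the torus `G_m²` cut out by a polynomial `f ∈ Qbar[X,Y]`:
the set of points `(x,y)` with `x, y ≠ 0` and `f(x,y) = 0`. -/
def curve (f : MvPolynomial (Fin 2) Qbar) : Set (Qbar × Qbar) :=
  {P | P.1 ≠ 0 ∧ P.2 ≠ 0 ∧ MvPolynomial.eval ![P.1, P.2] f = 0}

/-- A subset `C` of the torus `G_m²` is a translate of a subtorus if it is of the form
`{(x,y) : x^a y^b = c}` for some `(a,b) ∈ ℤ² \ {(0,0)}` and some `c ∈ Qbar^×`. -/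
def IsSubtorusTranslate (C : Set (Qbar × Qbar)) : Prop :=
  ∃ (a b : ℤ) (c : Qbar), ¬(a = 0 ∧ b = 0) ∧ c ≠ 0 ∧
    C = {P | P.1 ≠ 0 ∧ P.2 ≠ 0 ∧ P.1 ^ a * P.2 ^ b = c}

theorem two_mul_finrank_restrictTotalDegree_fin_two (K : Type*) [Field K] (n : ℕ) :
    2 * Module.finrank K (restrictTotalDegree (Fin 2) K n) = (n + 1) * (n + 2) := by
  have hset : {m : Fin 2 →₀ ℕ | (m.sum fun _ e => e) ≤ n} =
      ((Finset.range (n + 1)).biUnion fun k =>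
        Finset.finsuppAntidiag (Finset.univ : Finset (Fin 2)) k : Finset (Fin 2 →₀ ℕ)) := by
    ext m
    simp [Finsupp.sum_fintype]
  have hcard : Module.finrank K (restrictTotalDegree (Fin 2) K n) =
      ∑ k ∈ Finset.range (n + 1), (k + 1) := by
    rw [restrictTotalDegree, Module.finrank_eq_nat_card_basis (basisRestrictSupport K _), hset,
      Nat.card_coe_set_eq, Set.ncard_coe_finset, Finset.card_biUnion]
    · refine Finset.sum_congr rfl fun k _ => ?_
      rw [Finset.card_finsuppAntidiag_nat_eq_choose, ← Nat.choose_succ_self_right k]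
      simp [add_comm]
    · intro a _ b _ hab
      rw [Function.onFun, Finset.disjoint_left]
      intro m ha hb
      simp only [Finset.mem_finsuppAntidiag] at ha hb
      exact hab (ha.1.symm.trans hb.1)
  rw [hcard]
  clear hcard hset
  induction n with
  | zero => simp
  | succ n ih => rw [Finset.sum_range_succ, mul_add, ih]; ring

theorem coeff_X_mul_pderiv {σ R : Type*} [CommSemiring R] (i : σ) (f : MvPolynomial σ R)
    (m : σ →₀ ℕ) : coeff m (X i * pderiv i f) = m i * coeff m f := by
  induction f using MvPolynomial.induction_on' with
  | monomial s a =>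
    rw [pderiv_monomial, X, monomial_mul, coeff_monomial, coeff_monomial]
    by_cases h : s = m
    · subst h
      by_cases hs : s i = 0
      · simp [hs]
      · have : Finsupp.single i 1 + (s - Finsupp.single i 1) = s :=
          add_tsub_cancel_of_le (by simpa [Finsupp.single_le_iff] using Nat.one_le_iff_ne_zero.2 hs)
        rw [if_pos this, if_pos rfl]; ring
    · rw [if_neg h, mul_zero]
      by_cases hs : s i = 0
      · simp [hs]
      · have : Finsupp.single i 1 + (s - Finsupp.single i 1) = s :=
          add_tsub_cancel_of_le (by simpa [Finsupp.single_le_iff] using Nat.one_le_iff_ne_zero.2 hs)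
        rw [this, if_neg h]
  | add p q hp hq => rw [map_add, mul_add, coeff_add, hp, hq, coeff_add, mul_add]

theorem exists_eval_eq_zero_ne_zero {σ K : Type*} [Field K] (S : Finset (σ → K)) (P : σ → K) :
    ∃ l : MvPolynomial σ K, eval P l ≠ 0 ∧ ∀ Q ∈ S, Q ≠ P → eval Q l = 0 := by
  have h : ∀ Q : σ → K, Q ≠ P → ∃ i, Q i ≠ P i := fun Q hQ => Function.ne_iff.1 hQ
  choose i hi using h
  refine ⟨∏ Q ∈ S, if hQ : Q ≠ P then X (i Q hQ) - C (Q (i Q hQ)) else 1, ?_, ?_⟩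
  · rw [map_prod, Finset.prod_ne_zero_iff]
    intro Q _
    split_ifs with hQ
    · simpa using sub_ne_zero.2 (hi Q hQ).symm
    · simp
  · intro Q hQS hQ
    rw [map_prod, Finset.prod_eq_zero hQS]
    simp [hQ]

/-- Interpolation on a finite set of points by polynomials of any large enough degree bound. -/
theorem exists_forall_surjective_eval {σ K : Type*} [Field K] (S : Finset (σ → K)) :
    ∃ N : ℕ, ∀ n, N ≤ n → ∀ v : S → K,
      ∃ l ∈ restrictTotalDegree σ K n, ∀ P : S, eval P.1 l = v P := by
  choose l hl0 hl using fun P : S => exists_eval_eq_zero_ne_zero S P.1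
  refine ⟨Finset.univ.sup fun P => (l P).totalDegree, fun n hn v => ?_⟩
  refine ⟨∑ P, (v P / eval P.1 (l P)) • l P, ?_, fun Q => ?_⟩
  · refine Submodule.sum_mem _ fun P _ => Submodule.smul_mem _ _ ?_
    rw [mem_restrictTotalDegree]
    exact (Finset.le_sup (f := fun P => (l P).totalDegree) (Finset.mem_univ P)).trans hn
  · rw [map_sum, Finset.sum_eq_single Q]
    · simp [smul_eval, hl0 Q]
    · intro P _ hPQ
      rw [smul_eval, hl P Q.1 Q.2 (fun h => hPQ (Subtype.ext h.symm)), mul_zero]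
    · simp

/-- Affine Bézout bound: a prime `f` and a polynomial `g` not divisible by `f` have at most
`deg f * deg g` common zeros in the plane. -/
theorem card_common_zeros_le {K : Type*} [Field K] {f g : MvPolynomial (Fin 2) K}
    (hf : Prime f) (hfg : ¬ f ∣ g) (S : Finset (Fin 2 → K))
    (hS : ∀ P ∈ S, eval P f = 0 ∧ eval P g = 0) :
    S.card ≤ f.totalDegree * g.totalDegree := by
  obtain ⟨N, hN⟩ := exists_forall_surjective_eval S
  set d := f.totalDegree
  set e := g.totalDegree
  set W := restrictTotalDegree (Fin 2) K with hW
  have hmem : ∀ n p, p ∈ W n ↔ p.totalDegree ≤ n := fun n p => mem_restrictTotalDegree _ _ _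
  let ev : W (N + d + e) →ₗ[K] (S → K) :=
    (LinearMap.pi fun P : S => (aeval P.1).toLinearMap) ∘ₗ (W (N + d + e)).subtype
  have hev : ∀ l P, ev l P = eval P.1 l.1 := fun l P => by
    simp [ev, aeval_eq_eval]
  have hsurj : LinearMap.range ev = ⊤ := by
    rw [LinearMap.range_eq_top]
    intro v
    obtain ⟨l, hl, hlv⟩ := hN (N + d + e) (by omega) v
    exact ⟨⟨l, hl⟩, funext fun P => by rw [hev]; exact hlv P⟩
  let mul : (W (N + e) × W (N + d)) →ₗ[K] W (N + d + e) :=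
    LinearMap.codRestrict _
      ((LinearMap.mulLeft K f ∘ₗ (W (N + e)).subtype).coprod
        (LinearMap.mulLeft K g ∘ₗ (W (N + d)).subtype)) (by
      rintro ⟨⟨a, ha⟩, ⟨b, hb⟩⟩
      have ha' := (hmem _ _).1 ha
      have hb' := (hmem _ _).1 hb
      refine Submodule.add_mem _ ?_ ?_ <;> rw [hmem] <;>
        refine (totalDegree_mul _ _).trans ?_ <;>
        simp only [LinearMap.fst_apply, LinearMap.snd_apply, Submodule.subtype_apply] <;> omega)
  have hmul : ∀ x, (mul x).1 = f * x.1.1 + g * x.2.1 := fun x => rfl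
  have hrange : LinearMap.range mul ≤ LinearMap.ker ev := by
    rintro _ ⟨x, rfl⟩
    rw [LinearMap.mem_ker]
    funext P
    rw [hev, hmul]
    simp [hS P.1 P.2]
  have hker : Module.finrank K (LinearMap.ker mul) ≤ Module.finrank K (W N) := by
    let φ : W N →ₗ[K] (MvPolynomial (Fin 2) K × MvPolynomial (Fin 2) K) :=
      ((LinearMap.mulLeft K g).prod (-LinearMap.mulLeft K f)) ∘ₗ (W N).subtype
    let ι : LinearMap.ker mul →ₗ[K] (MvPolynomial (Fin 2) K × MvPolynomial (Fin 2) K) :=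
      ((W (N + e)).subtype.prodMap (W (N + d)).subtype) ∘ₗ (LinearMap.ker mul).subtype
    have hι : Function.Injective ι := by
      exact (Prod.map_injective.2
        ⟨Subtype.val_injective, Subtype.val_injective⟩).comp Subtype.val_injective
    have hle : LinearMap.range ι ≤ LinearMap.range φ := by
      rintro _ ⟨⟨⟨⟨a, ha⟩, ⟨b, hb⟩⟩, hx⟩, rfl⟩
      have h0 : f * a + g * b = 0 := by
        exact congrArg Subtype.val (LinearMap.mem_ker.1 hx)
      obtain ⟨c, rfl⟩ : f ∣ b :=
        (hf.dvd_or_dvd (show f ∣ g * b from ⟨-a, by linear_combination h0⟩)).resolve_left hfg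
      have hac : a = g * -c := mul_left_cancel₀ hf.ne_zero (by linear_combination h0)
      have hc : c.totalDegree ≤ N := by
        by_cases hc0 : c = 0
        · simp [hc0]
        · rw [hmem, totalDegree_mul_of_isDomain hf.ne_zero hc0] at hb
          omega
      refine ⟨⟨-c, ?_⟩, ?_⟩
      · rw [hmem, totalDegree_neg]
        exact hc
      · simp [φ, ι, hac]
    calc _ = Module.finrank K (LinearMap.range ι) := (LinearMap.finrank_range_of_inj hι).symm
      _ ≤ Module.finrank K (LinearMap.range φ) := Submodule.finrank_mono hle
      _ ≤ _ := LinearMap.finrank_range_le φ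
  have h1 := LinearMap.finrank_range_add_finrank_ker ev
  have h2 := LinearMap.finrank_range_add_finrank_ker mul
  have h3 := Submodule.finrank_mono hrange
  rw [hsurj, finrank_top, Module.finrank_fintype_fun_eq_card, Fintype.card_coe] at h1
  rw [Module.finrank_prod] at h2
  have d0 := two_mul_finrank_restrictTotalDegree_fin_two K N
  have d1 := two_mul_finrank_restrictTotalDegree_fin_two K (N + d)
  have d2 := two_mul_finrank_restrictTotalDegree_fin_two K (N + e)
  have d3 := two_mul_finrank_restrictTotalDegree_fin_two K (N + d + e)
  rw [← hW] at d0 d1 d2 d3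
  nlinarith

/-- A polynomial whose support lies on a line is, on the torus, a monomial times a Laurent
polynomial in a single character. -/
theorem aeval_eq_of_support_line {K L : Type*} [Field K] [Field L] [Algebra K L]
    {f : MvPolynomial (Fin 2) K} {a : Fin 2 →₀ ℕ} {r s : ℤ} {k : (Fin 2 →₀ ℕ) → ℤ}
    (hk : ∀ m ∈ f.support, (m 0 : ℤ) = a 0 + r * k m ∧ (m 1 : ℤ) = a 1 + s * k m)
    {x y : L} (hx : x ≠ 0) (hy : y ≠ 0) :
    aeval ![x, y] f = x ^ a 0 * y ^ a 1 *
      ∑ m ∈ f.support, algebraMap K L (coeff m f) * (x ^ r * y ^ s) ^ k m := by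
  rw [aeval_def, eval₂_eq', Finset.mul_sum]
  refine Finset.sum_congr rfl fun m hm => ?_
  obtain ⟨h0, h1⟩ := hk m hm
  rw [Fin.prod_univ_two]
  simp only [Matrix.cons_val_zero, Matrix.cons_val_one]
  rw [← zpow_natCast x, ← zpow_natCast y, h0, h1, zpow_add₀ hx, zpow_add₀ hy, zpow_natCast,
    zpow_natCast, mul_zpow, ← zpow_mul, ← zpow_mul]
  ring

theorem isAlgebraic_of_sum_zpow_eq_zero {ι K L : Type*} [Field K] [Field L] [Algebra K L]
    {S : Finset ι} {c : ι → K} {k : ι → ℤ} (hk : Set.InjOn k S) {i : ι} (hi : i ∈ S)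
    (hci : c i ≠ 0) {w : L} (hw : w ≠ 0)
    (h : ∑ j ∈ S, algebraMap K L (c j) * w ^ k j = 0) : IsAlgebraic K w := by
  set N : ℕ := ∑ j ∈ S, (k j).natAbs
  have hnat : ∀ j ∈ S, (((k j + N).toNat : ℕ) : ℤ) = k j + N := fun j hj => by
    have : (k j).natAbs ≤ N := Finset.single_le_sum (f := fun j => (k j).natAbs)
      (fun _ _ => Nat.zero_le _) hj
    omega
  refine ⟨∑ j ∈ S, Polynomial.C (c j) * Polynomial.X ^ (k j + N).toNat, fun h0 => hci ?_, ?_⟩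
  · have := congrArg (fun P => Polynomial.coeff P (k i + N).toNat) h0
    simp only [Polynomial.finsetSum_coeff, Polynomial.coeff_C_mul_X_pow,
      Polynomial.coeff_zero] at this
    rw [Finset.sum_eq_single i] at this
    · simpa using this
    · intro j hj hji
      rw [if_neg]
      intro he
      refine hji (hk hj hi ?_)
      have h1 := hnat i hi
      have h2 := hnat j hj
      omega
    · exact fun h => absurd hi h
  · rw [map_sum, ← zero_mul (w ^ N), ← h, Finset.sum_mul]
    refine Finset.sum_congr rfl fun j hj => ?_
    rw [map_mul, Polynomial.aeval_C, map_pow, Polynomial.aeval_X, ← zpow_natCast w, hnat j hj,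
      zpow_add₀ hw, zpow_natCast, mul_assoc]

theorem exists_algebraMap_eq_of_isAlgebraic {K L : Type*} [Field K] [IsAlgClosed K] [Field L]
    [Algebra K L] {w : L} (hw : IsAlgebraic K w) : ∃ t : K, algebraMap K L t = w :=
  minpoly.mem_range_of_degree_eq_one K w
    (IsAlgClosed.degree_eq_one_of_irreducible K (minpoly.irreducible hw.isIntegral))

theorem zpow_mul_zpow_eq_iff {L : Type*} [Field L] {x y : L} (hx : x ≠ 0) (hy : y ≠ 0)
    (r s : ℤ) (c : L) : x ^ r * y ^ s = c ↔
      x ^ r.toNat * y ^ s.toNat = c * (x ^ (-r).toNat * y ^ (-s).toNat) := by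
  have key : ∀ {z : L}, z ≠ 0 → ∀ n : ℤ, z ^ n = z ^ n.toNat / z ^ (-n).toNat := by
    intro z hz n
    rw [← zpow_natCast, ← zpow_natCast, ← zpow_sub₀ hz, Int.toNat_sub_toNat_neg]
  rw [key hx, key hy, div_mul_div_comm, div_eq_iff]
  exact mul_ne_zero (pow_ne_zero _ hx) (pow_ne_zero _ hy)

/-- An irreducible plane curve whose support lies on a line of primitive direction `(r, s)` and
which is not a coordinate axis is a translate of the subtorus `x ^ r * y ^ s = 1`. -/
theorem exists_eval_eq_zero_iff_zpow_mul_zpow_eq {K : Type*} [Field K] [IsAlgClosed K]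
    {f : MvPolynomial (Fin 2) K} (hf : Prime f) (hX : ¬ f ∣ X 0) (hY : ¬ f ∣ X 1)
    {a : Fin 2 →₀ ℕ} {r s : ℤ} {k : (Fin 2 →₀ ℕ) → ℤ}
    (hk : ∀ m ∈ f.support, (m 0 : ℤ) = a 0 + r * k m ∧ (m 1 : ℤ) = a 1 + s * k m) :
    ∃ c : K, c ≠ 0 ∧ ∀ x y : K, x ≠ 0 → y ≠ 0 →
      (eval ![x, y] f = 0 ↔ x ^ r * y ^ s = c) := by
  have hprime : (Ideal.span {f}).IsPrime := (Ideal.span_singleton_prime hf.ne_zero).2 hf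
  let L := FractionRing (MvPolynomial (Fin 2) K ⧸ Ideal.span {f})
  let π : MvPolynomial (Fin 2) K →ₐ[K] L :=
    (IsScalarTower.toAlgHom K (MvPolynomial (Fin 2) K ⧸ Ideal.span {f}) L).comp
      (Ideal.Quotient.mkₐ K (Ideal.span {f}))
  have hπ : ∀ g, π g = 0 ↔ f ∣ g := by
    intro g
    rw [← Ideal.mem_span_singleton, ← Ideal.Quotient.eq_zero_iff_mem]
    exact FaithfulSMul.algebraMap_eq_zero_iff (MvPolynomial (Fin 2) K ⧸ Ideal.span {f}) L
  have hx : π (X 0) ≠ 0 := fun h => hX ((hπ _).1 h)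
  have hy : π (X 1) ≠ 0 := fun h => hY ((hπ _).1 h)
  have hπf : aeval ![π (X 0), π (X 1)] f = 0 := by
    rw [← (hπ f).2 dvd_rfl]
    refine DFunLike.congr_fun (MvPolynomial.algHom_ext fun i => ?_ : aeval _ = π) f
    fin_cases i <;> simp
  rw [aeval_eq_of_support_line hk hx hy] at hπf
  have hsum := (mul_eq_zero.1 hπf).resolve_left
    (mul_ne_zero (pow_ne_zero _ hx) (pow_ne_zero _ hy))
  have hw : π (X 0) ^ r * π (X 1) ^ s ≠ 0 := mul_ne_zero (zpow_ne_zero _ hx) (zpow_ne_zero _ hy)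
  have hinj : Set.InjOn k f.support := by
    intro m hm m' hm' h
    obtain ⟨h0, h1⟩ := hk m hm
    obtain ⟨h0', h1'⟩ := hk m' hm'
    ext i
    fin_cases i
    · exact_mod_cast (show (m 0 : ℤ) = m' 0 by rw [h0, h0', h])
    · exact_mod_cast (show (m 1 : ℤ) = m' 1 by rw [h1, h1', h])
  obtain ⟨i, hi⟩ := support_nonempty.2 hf.ne_zero
  obtain ⟨c, hc⟩ := exists_algebraMap_eq_of_isAlgebraic
    (isAlgebraic_of_sum_zpow_eq_zero hinj hi (mem_support_iff.1 hi) hw hsum)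
  refine ⟨c, fun h0 => hw (by rw [← hc, h0, map_zero]), fun x y hx0 hy0 =>
    ⟨fun h => ?_, fun h => ?_⟩⟩
  · have hdvd : f ∣ X 0 ^ r.toNat * X 1 ^ s.toNat -
        C c * (X 0 ^ (-r).toNat * X 1 ^ (-s).toNat) := by
      rw [← hπ, map_sub, sub_eq_zero, map_mul, map_mul, map_mul, map_pow, map_pow, map_pow, map_pow,
        ← algebraMap_eq, AlgHom.commutes]
      exact (zpow_mul_zpow_eq_iff hx hy r s _).1 hc.symm
    obtain ⟨u, hu⟩ := hdvd
    have := congrArg (eval ![x, y]) hu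
    rw [map_mul _ f, h, zero_mul] at this
    rw [zpow_mul_zpow_eq_iff hx0 hy0, ← sub_eq_zero]
    simpa using this
  · rw [← hc] at hsum
    rw [← aeval_eq_eval, aeval_eq_of_support_line hk hx0 hy0, h]
    refine mul_eq_zero_of_right _ ((algebraMap K L).injective ?_)
    simpa using hsum

theorem fiber_finite_ncard_le {K : Type*} [Field K] {f g : MvPolynomial (Fin 2) K}
    (hf : Prime f) (hfg : ¬ f ∣ g) (hdeg : g.totalDegree ≤ f.totalDegree) {T : Set (K × K)}
    (hT : ∀ P ∈ T, eval ![P.1, P.2] f = 0 ∧ eval ![P.1, P.2] g = 0) :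
    T.Finite ∧ T.ncard ≤ f.totalDegree ^ 2 := by
  have hinj : Function.Injective fun P : K × K => ![P.1, P.2] := fun P Q h =>
    Prod.ext (congrFun h 0) (congrFun h 1)
  have hle : ∀ S : Finset (K × K), ↑S ⊆ T → S.card ≤ f.totalDegree ^ 2 := by
    intro S hS
    rw [← Finset.card_image_of_injective S hinj, sq]
    refine (card_common_zeros_le hf hfg _ ?_).trans (Nat.mul_le_mul_left _ hdeg)
    intro P hP
    obtain ⟨Q, hQ, rfl⟩ := Finset.mem_image.1 hP
    exact hT Q (hS hQ)
  have hfin : T.Finite := by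
    by_contra hinf
    obtain ⟨S, hS, hcard⟩ := Set.Infinite.exists_subset_card_eq hinf (f.totalDegree ^ 2 + 1)
    have := hle S hS
    omega
  refine ⟨hfin, ?_⟩
  rw [Set.ncard_eq_toFinset_card T hfin]
  exact hle _ (by simp)

/-- If `f` divides `q X ∂f/∂X - p Y ∂f/∂Y`, then the support of `f` lies on a line of primitive
direction proportional to `(p, q)`. -/
theorem exists_support_line_of_dvd {K : Type*} [Field K] [CharZero K] {f : MvPolynomial (Fin 2) K}
    (hf0 : f ≠ 0) {p q : ℤ} (hpq : ¬(p = 0 ∧ q = 0))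
    {g : MvPolynomial (Fin 2) K} (hdeg : g.totalDegree ≤ f.totalDegree)
    (hg : ∀ m, coeff m g = (q * m 0 - p * m 1) * coeff m f) (hfg : f ∣ g) :
    ∃ (a : Fin 2 →₀ ℕ) (r s : ℤ) (k : (Fin 2 →₀ ℕ) → ℤ), ¬(r = 0 ∧ s = 0) ∧
      ∀ m ∈ f.support, (m 0 : ℤ) = a 0 + r * k m ∧ (m 1 : ℤ) = a 1 + s * k m := by
  obtain ⟨c, hc⟩ : ∃ c : K, g = C c * f := by
    obtain ⟨u, rfl⟩ := hfg
    by_cases hu : u = 0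
    · exact ⟨0, by simp [hu]⟩
    · rw [totalDegree_mul_of_isDomain hf0 hu] at hdeg
      exact ⟨coeff 0 u, by rw [mul_comm, ← totalDegree_eq_zero_iff_eq_C.1 (by omega)]⟩
  have hline : ∀ m ∈ f.support, (q * m 0 - p * m 1 : K) = c := by
    intro m hm
    have := hg m
    rw [hc, coeff_C_mul] at this
    exact (mul_right_cancel₀ (mem_support_iff.1 hm) this).symm
  obtain ⟨a, ha⟩ := support_nonempty.2 hf0
  have hpos : 0 < Int.gcd p q := Nat.pos_of_ne_zero fun h => hpq (Int.gcd_eq_zero_iff.1 h)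
  obtain ⟨r, s, hrs, hp, hq⟩ := Int.exists_gcd_one hpos
  obtain ⟨u, v, huv⟩ := Int.isCoprime_iff_gcd_eq_one.2 hrs
  refine ⟨a, r, s, fun m => u * (m 0 - a 0) + v * (m 1 - a 1), ?_, fun m hm => ?_⟩
  · rintro ⟨rfl, rfl⟩
    simp at huv
  · have h1 : (q * (m 0 - a 0) : ℤ) = p * (m 1 - a 1) := by
      have h2 : (q * m 0 - p * m 1 : K) = q * a 0 - p * a 1 := (hline m hm).trans (hline a ha).symm
      have h3 : (q * m 0 - p * m 1 : ℤ) = q * a 0 - p * a 1 := by exact_mod_cast h2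
      linarith
    have h4 : (s * (m 0 - a 0) : ℤ) = r * (m 1 - a 1) := by
      have hd : (Int.gcd p q : ℤ) ≠ 0 := by exact_mod_cast hpos.ne'
      refine mul_right_cancel₀ hd ?_
      linear_combination h1 - (m 0 - a 0 : ℤ) * hq + (m 1 - a 1 : ℤ) * hp
    constructor
    · linear_combination (a 0 - m 0 : ℤ) * huv + v * h4
    · linear_combination (a 1 - m 1 : ℤ) * huv - u * h4

/-- **Lemma (fibers of the tangent map are small).**
Let `f ∈ Qbar[X,Y]` be irreducible, defining a curve `C` in `G_m²` which is not a translate of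
a subtorus.  Then for every pair of integers `(p,q) ≠ (0,0)`, the fiber `σ_C⁻¹(p:q)` of the
tangent map — the set of smooth points `P = (x,y)` of `C` with
`q·x·(∂f/∂X)(P) = p·y·(∂f/∂Y)(P)` — is finite of cardinality at most `(deg f)²`. -/
theorem tangent_map_fiber_card_le
    (f : MvPolynomial (Fin 2) Qbar) (hirr : Irreducible f)
    (hnt : ¬ IsSubtorusTranslate (curve f))
    (p q : ℤ) (hpq : ¬(p = 0 ∧ q = 0)) :
    ({P : Qbar × Qbar | P.1 ≠ 0 ∧ P.2 ≠ 0 ∧ MvPolynomial.eval ![P.1, P.2] f = 0 ∧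
      ¬(MvPolynomial.eval ![P.1, P.2] (MvPolynomial.pderiv 0 f) = 0 ∧
        MvPolynomial.eval ![P.1, P.2] (MvPolynomial.pderiv 1 f) = 0) ∧
      (q : Qbar) * P.1 * MvPolynomial.eval ![P.1, P.2] (MvPolynomial.pderiv 0 f)
        = (p : Qbar) * P.2 * MvPolynomial.eval ![P.1, P.2] (MvPolynomial.pderiv 1 f)}).Finite ∧
    ({P : Qbar × Qbar | P.1 ≠ 0 ∧ P.2 ≠ 0 ∧ MvPolynomial.eval ![P.1, P.2] f = 0 ∧
      ¬(MvPolynomial.eval ![P.1, P.2] (MvPolynomial.pderiv 0 f) = 0 ∧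
        MvPolynomial.eval ![P.1, P.2] (MvPolynomial.pderiv 1 f) = 0) ∧
      (q : Qbar) * P.1 * MvPolynomial.eval ![P.1, P.2] (MvPolynomial.pderiv 0 f)
        = (p : Qbar) * P.2 * MvPolynomial.eval ![P.1, P.2] (MvPolynomial.pderiv 1 f)}).ncard ≤
      f.totalDegree ^ 2 := by
  have hf : Prime f := hirr.prime
  set g : MvPolynomial (Fin 2) Qbar :=
    C (q : Qbar) * (X 0 * pderiv 0 f) - C (p : Qbar) * (X 1 * pderiv 1 f) with hgdef
  have hg : ∀ m, coeff m g = (q * m 0 - p * m 1) * coeff m f := by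
    intro m
    rw [hgdef, coeff_sub, coeff_C_mul, coeff_C_mul, coeff_X_mul_pderiv, coeff_X_mul_pderiv]
    ring
  have hdeg : g.totalDegree ≤ f.totalDegree := by
    refine totalDegree_le_of_support_subset fun m hm => ?_
    rw [mem_support_iff, hg] at hm
    exact mem_support_iff.2 (right_ne_zero_of_mul hm)
  by_cases hfg : f ∣ g
  · by_cases hne : (curve f).Nonempty
    · obtain ⟨P, hP1, hP2, hP⟩ := hne
      have hX : ∀ i, ![P.1, P.2] i ≠ 0 → ¬ f ∣ X i := by
        rintro i hi ⟨u, hu⟩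
        apply hi
        rw [← eval_X (f := ![P.1, P.2]) i, hu, map_mul, hP, zero_mul]
      obtain ⟨a, r, s, k, hrs0, hk⟩ := exists_support_line_of_dvd hf.ne_zero hpq hdeg hg hfg
      obtain ⟨c, hc0, hc⟩ :=
        exists_eval_eq_zero_iff_zpow_mul_zpow_eq hf (hX 0 hP1) (hX 1 hP2) hk
      refine absurd ⟨r, s, c, hrs0, hc0, ?_⟩ hnt
      ext ⟨x, y⟩
      exact and_congr_right fun hx => and_congr_right fun hy => hc x y hx hy
    · have hempty : ∀ T : Set (Qbar × Qbar), T ⊆ curve f →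
          T.Finite ∧ T.ncard ≤ f.totalDegree ^ 2 := by
        intro T hT
        rw [Set.not_nonempty_iff_eq_empty.1 hne, Set.subset_empty_iff] at hT
        simp [hT]
      exact hempty _ fun P hP => ⟨hP.1, hP.2.1, hP.2.2.1⟩
  · refine fiber_finite_ncard_le hf hfg hdeg fun P hP => ⟨hP.2.2.1, ?_⟩
    have h := hP.2.2.2.2
    simp only [hgdef, map_sub, map_mul, eval_C, eval_X, Matrix.cons_val_zero, Matrix.cons_val_one]
    linear_combination h
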